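/- arXiv:0910.4426 — 4 statements merged into one kernel-verified Lean document; each statement's English description precedes it below -/
import Mathlib

section
/- Let n ≥ 2 be an integer and let a₁, …, aₙ be positive real numbers. Then ∑_{i=1}^n 1/aᵢ ≥ ( (∑_{i=1}^n aᵢ) / (∏_{i=1}^n aᵢ) )^{1/(n-1)}. -/
theorem Finset.prod_le_sum_pow_card {ι : Type*} (s : Finset ι) (x : ι → ℝ)
    (hx : ∀ i ∈ s, 0 ≤ x i) : ∏ i ∈ s, x i ≤ (∑ i ∈ s, x i) ^ s.card := by
  rw [← Finset.prod_const]
  exact Finset.prod_le_prod hx fun i hi => Finset.single_le_sum hx hi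

/-- The elementary symmetric polynomial of degree `#s - 1` in positive reals, written as
`(∏ xᵢ) * ∑ xᵢ⁻¹`, is at most `(∑ xᵢ) ^ (#s - 1)`. -/
theorem Finset.prod_mul_sum_inv_le_sum_pow {ι : Type*} {s : Finset ι} (hs : s.Nonempty)
    (x : ι → ℝ) (hx : ∀ i ∈ s, 0 < x i) :
    (∏ i ∈ s, x i) * ∑ i ∈ s, (x i)⁻¹ ≤ (∑ i ∈ s, x i) ^ (s.card - 1) := by
  induction hs using Finset.Nonempty.cons_induction with
  | singleton b => simp [(hx b (by simp)).ne']
  | cons b s hb hs ih =>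
    have hxs : ∀ i ∈ s, 0 < x i := fun i hi => hx i (Finset.mem_cons_of_mem hi)
    have hxb : 0 < x b := hx b (Finset.mem_cons_self b s)
    have hS : 0 < ∑ i ∈ s, x i := Finset.sum_pos hxs hs
    have hP := Finset.prod_le_sum_pow_card s x fun i hi => (hxs i hi).le
    specialize ih hxs
    obtain ⟨m, hm⟩ : ∃ m, s.card = m + 1 := Nat.exists_eq_succ_of_ne_zero hs.card_ne_zero
    rw [Finset.prod_cons, Finset.sum_cons, Finset.sum_cons, Finset.card_cons]
    simp only [hm, Nat.add_sub_cancel] at ih hP ⊢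
    calc x b * (∏ i ∈ s, x i) * ((x b)⁻¹ + ∑ i ∈ s, (x i)⁻¹)
        = ∏ i ∈ s, x i + x b * ((∏ i ∈ s, x i) * ∑ i ∈ s, (x i)⁻¹) := by
          field_simp
      _ ≤ (∑ i ∈ s, x i) ^ (m + 1) + x b * (∑ i ∈ s, x i) ^ m := by gcongr
      _ = (∑ i ∈ s, x i) ^ m * (x b + ∑ i ∈ s, x i) := by ring
      _ ≤ (x b + ∑ i ∈ s, x i) ^ m * (x b + ∑ i ∈ s, x i) := by
          gcongr
          linarith
      _ = (x b + ∑ i ∈ s, x i) ^ (m + 1) := (pow_succ _ _).symm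

/-- For `n ≥ 2` positive reals `a₁, …, aₙ`:
`∑ 1/aᵢ ≥ ((∑ aᵢ)/(∏ aᵢ))^{1/(n-1)}`. -/
theorem sum_inv_ge_sum_div_prod_rpow
    (n : ℕ) (hn : 2 ≤ n) (a : Fin n → ℝ) (ha : ∀ i, 0 < a i) :
    ((∑ i, a i) / (∏ i, a i)) ^ ((1 : ℝ) / (n - 1)) ≤ ∑ i, 1 / a i := by
  have : NeZero n := ⟨by omega⟩
  have key := Finset.prod_mul_sum_inv_le_sum_pow (Finset.univ_nonempty (α := Fin n))
    (fun i => (a i)⁻¹) fun i _ => inv_pos.2 (ha i)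
  simp only [inv_inv, Finset.prod_inv_distrib, Finset.card_univ, Fintype.card_fin] at key
  rw [inv_mul_eq_div] at key
  have hcast : (n : ℝ) - 1 = ((n - 1 : ℕ) : ℝ) := by
    rw [Nat.cast_sub (by omega), Nat.cast_one]
  simp only [one_div, hcast]
  have hnonneg : 0 ≤ ∑ i, (a i)⁻¹ := Finset.sum_nonneg fun i _ => (inv_pos.2 (ha i)).le
  have hbase : 0 ≤ (∑ i, a i) / ∏ i, a i :=
    div_nonneg (Finset.sum_nonneg fun i _ => (ha i).le) (Finset.prod_nonneg fun i _ => (ha i).le)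
  calc ((∑ i, a i) / ∏ i, a i) ^ (((n - 1 : ℕ) : ℝ)⁻¹)
      ≤ ((∑ i, (a i)⁻¹) ^ (n - 1)) ^ (((n - 1 : ℕ) : ℝ)⁻¹) :=
        Real.rpow_le_rpow hbase key (by positivity)
    _ = ∑ i, (a i)⁻¹ := Real.pow_rpow_inv_natCast hnonneg (by omega)
end

section
/- Let E be a real normed vector space, 0 < α < 1, A ≥ 0, 0 < τ < 1, and let w₀ : E × ℝ → ℝ satisfy |w₀(x,t) − w₀(x′,t′)| ≤ A(‖x−x′‖^α + |t−t′|^{α/2}) for all x, x′ ∈ E and t, t′ ∈ [0,1], and w₀(x,0) = 0 for all x. Define w_τ(x,t) = 0 for t ≤ τ and w_τ(x,t) = w₀(x, t−τ) for t > τ, and set η = w_τ − w₀. Then for all x, x′ ∈ E and all t, t′ ∈ [0,τ], |η(x,t) − η(x′,t′)| ≤ 2A τ^{α/4} ( ‖x−x′‖^{α/2} + |t−t′|^{α/4} ). -/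
/-- Case 1 of Claim 2 in Lemma 2.2: with `w_τ` the time-shift of `w₀` by `τ`
(extended by `0`) and `η = w_τ − w₀`, for `t, t′ ∈ [0,τ]`,
`|η(x,t) − η(x′,t′)| ≤ 2A τ^{α/4}(‖x−x′‖^{α/2} + |t−t′|^{α/4})`. -/
theorem shift_difference_holder_case1
    {E : Type*} [NormedAddCommGroup E] [NormedSpace ℝ E]
    (α A τ : ℝ) (hα0 : 0 < α) (hα1 : α < 1) (hA : 0 ≤ A)
    (hτ0 : 0 < τ) (hτ1 : τ < 1)
    (w₀ : E → ℝ → ℝ)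
    (hHolder : ∀ x x' : E, ∀ t ∈ Set.Icc (0 : ℝ) 1, ∀ t' ∈ Set.Icc (0 : ℝ) 1,
      |w₀ x t - w₀ x' t'| ≤ A * (‖x - x'‖ ^ α + |t - t'| ^ (α / 2)))
    (hzero : ∀ x : E, w₀ x 0 = 0)
    (wτ : E → ℝ → ℝ)
    (hwτle : ∀ x : E, ∀ t : ℝ, t ≤ τ → wτ x t = 0)
    (hwτgt : ∀ x : E, ∀ t : ℝ, τ < t → wτ x t = w₀ x (t - τ))
    (η : E → ℝ → ℝ) (hη : ∀ x t, η x t = wτ x t - w₀ x t) :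
    ∀ x x' : E, ∀ t ∈ Set.Icc (0 : ℝ) τ, ∀ t' ∈ Set.Icc (0 : ℝ) τ,
      |η x t - η x' t'| ≤
        2 * A * τ ^ (α / 4) * (‖x - x'‖ ^ (α / 2) + |t - t'| ^ (α / 4)) := by
  intro x x' t ht t' ht'
  have sq_half : ∀ a b : ℝ, 0 ≤ a → a ^ b = (a ^ (b / 2)) ^ 2 := fun a b ha => by
    rw [← Real.rpow_mul_natCast ha]
    congr 1
    push_cast
    ring
  have sq_quarter : ∀ a : ℝ, 0 ≤ a → a ^ (α / 2) = (a ^ (α / 4)) ^ 2 := fun a ha => by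
    rw [sq_half a (α / 2) ha, div_div]
    norm_num
  have bound : ∀ y : E, ∀ s ∈ Set.Icc (0 : ℝ) τ, |w₀ y s| ≤ A * (τ ^ (α / 4)) ^ 2 := by
    intro y s hs
    have h := hHolder y y s ⟨hs.1, hs.2.trans hτ1.le⟩ 0 ⟨le_rfl, zero_le_one⟩
    rw [hzero, sub_self, norm_zero, Real.zero_rpow hα0.ne', zero_add, sub_zero, sub_zero,
      abs_of_nonneg hs.1] at h
    rw [← sq_quarter τ hτ0.le]
    exact h.trans (mul_le_mul_of_nonneg_left
      (Real.rpow_le_rpow hs.1 hs.2 (by positivity)) hA)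
  have hdiff : |η x t - η x' t'| = |w₀ x t - w₀ x' t'| := by
    rw [hη, hη, hwτle x t ht.2, hwτle x' t' ht'.2, zero_sub, zero_sub, neg_sub_neg, abs_sub_comm]
  have hsup : |w₀ x t - w₀ x' t'| ≤ 2 * A * (τ ^ (α / 4)) ^ 2 := by
    linarith [abs_sub (w₀ x t) (w₀ x' t'), bound x t ht, bound x' t' ht']
  have hhol := hHolder x x' t ⟨ht.1, ht.2.trans hτ1.le⟩ t' ⟨ht'.1, ht'.2.trans hτ1.le⟩
  rw [sq_half _ α (norm_nonneg _), sq_quarter _ (abs_nonneg _)] at hhol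
  have hqr : |t - t'| ^ (α / 4) ≤ τ ^ (α / 4) :=
    Real.rpow_le_rpow (abs_nonneg _)
      (abs_le.2 ⟨by linarith [ht.1, ht'.2], by linarith [ht.2, ht'.1]⟩) (by positivity)
  have hp : 0 ≤ ‖x - x'‖ ^ (α / 2) := by positivity
  have hq : 0 ≤ |t - t'| ^ (α / 4) := by positivity
  have hr : 0 ≤ τ ^ (α / 4) := by positivity
  rw [hdiff]
  generalize ‖x - x'‖ ^ (α / 2) = p at *
  generalize |t - t'| ^ (α / 4) = q at *
  generalize τ ^ (α / 4) = r at *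
  rcases le_total r p with h | h
  · calc _ ≤ 2 * A * r ^ 2 := hsup
      _ = 2 * A * r * r := by ring
      _ ≤ 2 * A * r * (p + q) := by gcongr; linarith
  · calc _ ≤ A * (p ^ 2 + q ^ 2) := hhol
      _ ≤ A * (2 * r * (p + q)) := by gcongr; nlinarith
      _ = 2 * A * r * (p + q) := by ring
end

section
/- Let E be a real normed vector space, 0 < α < 1, A ≥ 0, 0 < τ < 1, and let w₀ : E × ℝ → ℝ satisfy |w₀(x,t) − w₀(x′,t′)| ≤ A(‖x−x′‖^α + |t−t′|^{α/2}) for all x, x′ ∈ E and t, t′ ∈ [0,1], and w₀(x,0) = 0 for all x. Define w_τ(x,t) = 0 for t ≤ τ and w_τ(x,t) = w₀(x, t−τ) for t > τ, and set η = w_τ − w₀. Then for all x, x′ ∈ E and all t, t′ ∈ [τ,1], |η(x,t) − η(x′,t′)| ≤ 2A τ^{α/4} ( ‖x−x′‖^{α/2} + |t−t′|^{α/4} ). -/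
/-- Case 2 of Claim 2 in Lemma 2.2: with `w_τ` the time-shift of `w₀` by `τ`
(extended by `0`) and `η = w_τ − w₀`, for `t, t′ ∈ [τ,1]`,
`|η(x,t) − η(x′,t′)| ≤ 2A τ^{α/4}(‖x−x′‖^{α/2} + |t−t′|^{α/4})`. -/
theorem shift_difference_holder_case2
    {E : Type*} [NormedAddCommGroup E] [NormedSpace ℝ E]
    (α A τ : ℝ) (hα0 : 0 < α) (hα1 : α < 1) (hA : 0 ≤ A)
    (hτ0 : 0 < τ) (hτ1 : τ < 1)
    (w₀ : E → ℝ → ℝ)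
    (hHolder : ∀ x x' : E, ∀ t ∈ Set.Icc (0 : ℝ) 1, ∀ t' ∈ Set.Icc (0 : ℝ) 1,
      |w₀ x t - w₀ x' t'| ≤ A * (‖x - x'‖ ^ α + |t - t'| ^ (α / 2)))
    (hzero : ∀ x : E, w₀ x 0 = 0)
    (wτ : E → ℝ → ℝ)
    (hwτle : ∀ x : E, ∀ t : ℝ, t ≤ τ → wτ x t = 0)
    (hwτgt : ∀ x : E, ∀ t : ℝ, τ < t → wτ x t = w₀ x (t - τ))
    (η : E → ℝ → ℝ) (hη : ∀ x t, η x t = wτ x t - w₀ x t) :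
    ∀ x x' : E, ∀ t ∈ Set.Icc τ (1 : ℝ), ∀ t' ∈ Set.Icc τ (1 : ℝ),
      |η x t - η x' t'| ≤
        2 * A * τ ^ (α / 4) * (‖x - x'‖ ^ (α / 2) + |t - t'| ^ (α / 4)) := by
  have hshift : ∀ x : E, ∀ t ∈ Set.Icc τ (1 : ℝ), η x t = w₀ x (t - τ) - w₀ x t := by
    rintro x t ⟨ht, -⟩
    rcases ht.eq_or_lt with rfl | h
    · rw [hη, hwτle x τ le_rfl, sub_self, hzero]
    · rw [hη, hwτgt x t h]
  have hsq : ∀ y β : ℝ, 0 ≤ y → y ^ β = (y ^ (β / 2)) ^ 2 := by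
    intro y β hy
    rw [← Real.rpow_mul_natCast hy]
    congr 1
    push_cast
    ring
  have hsmall : ∀ x : E, ∀ t ∈ Set.Icc τ (1 : ℝ), |η x t| ≤ A * τ ^ (α / 2) := by
    intro x t ht
    have h := hHolder x x (t - τ) ⟨by linarith [ht.1], by linarith [ht.2]⟩
      t ⟨by linarith [ht.1], ht.2⟩
    rw [hshift x t ht]
    simpa [Real.zero_rpow hα0.ne', abs_of_pos hτ0] using h
  intro x x' t ht t' ht'
  have hτbound : |η x t - η x' t'| ≤ 2 * A * τ ^ (α / 2) := by
    linarith [abs_sub (η x t) (η x' t'), hsmall x t ht, hsmall x' t' ht']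
  have hdist : |η x t - η x' t'| ≤ 2 * A * (‖x - x'‖ ^ α + |t - t'| ^ (α / 2)) := by
    have h₁ := hHolder x x' (t - τ) ⟨by linarith [ht.1], by linarith [ht.2]⟩
      (t' - τ) ⟨by linarith [ht'.1], by linarith [ht'.2]⟩
    have h₂ := hHolder x x' t ⟨by linarith [ht.1], ht.2⟩ t' ⟨by linarith [ht'.1], ht'.2⟩
    rw [sub_sub_sub_cancel_right] at h₁
    rw [hshift x t ht, hshift x' t' ht', sub_sub_sub_comm]
    linarith [abs_sub (w₀ x (t - τ) - w₀ x' (t' - τ)) (w₀ x t - w₀ x' t')]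
  have hquarter : α / 2 / 2 = α / 4 := by ring
  rw [hsq τ _ hτ0.le, hquarter] at hτbound
  rw [hsq _ α (norm_nonneg _), hsq _ (α / 2) (abs_nonneg _), hquarter] at hdist
  have hp : 0 ≤ τ ^ (α / 4) := by positivity
  have ha : 0 ≤ ‖x - x'‖ ^ (α / 2) := by positivity
  have hb : 0 ≤ |t - t'| ^ (α / 4) := by positivity
  generalize τ ^ (α / 4) = p at *
  generalize ‖x - x'‖ ^ (α / 2) = a at *
  generalize |t - t'| ^ (α / 4) = b at *
  rw [mul_assoc]
  rcases le_total p (a + b) with h | h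
  · refine hτbound.trans ?_
    rw [mul_assoc, mul_assoc]
    gcongr
    nlinarith
  · refine hdist.trans ?_
    rw [mul_assoc, mul_assoc]
    gcongr
    nlinarith [mul_nonneg ha hb]
end

section
/- Let E be a real normed vector space, 0 < α < 1, A ≥ 0, 0 < τ < 1, and let w₀ : E × ℝ → ℝ satisfy |w₀(x,t) − w₀(x′,t′)| ≤ A(‖x−x′‖^α + |t−t′|^{α/2}) for all x, x′ ∈ E and t, t′ ∈ [0,1], and w₀(x,0) = 0 for all x. Define w_τ(x,t) = 0 for t ≤ τ and w_τ(x,t) = w₀(x, t−τ) for t > τ, and set η = w_τ − w₀. Then for all x, x′ ∈ E and all t, t′ ∈ [0,1], |η(x,t) − η(x′,t′)| ≤ 4A τ^{α/4} ( ‖x−x′‖^{α/2} + |t−t′|^{α/4} ). -/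
/-- Claim 2 in Lemma 2.2: with `w_τ` the time-shift of `w₀` by `τ`
(extended by `0`) and `η = w_τ − w₀`, for all `t, t′ ∈ [0,1]`,
`|η(x,t) − η(x′,t′)| ≤ 4A τ^{α/4}(‖x−x′‖^{α/2} + |t−t′|^{α/4})`. -/
theorem shift_difference_holder_full
    {E : Type*} [NormedAddCommGroup E] [NormedSpace ℝ E]
    (α A τ : ℝ) (hα0 : 0 < α) (hα1 : α < 1) (hA : 0 ≤ A)
    (hτ0 : 0 < τ) (hτ1 : τ < 1)
    (w₀ : E → ℝ → ℝ)
    (hHolder : ∀ x x' : E, ∀ t ∈ Set.Icc (0 : ℝ) 1, ∀ t' ∈ Set.Icc (0 : ℝ) 1,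
      |w₀ x t - w₀ x' t'| ≤ A * (‖x - x'‖ ^ α + |t - t'| ^ (α / 2)))
    (hzero : ∀ x : E, w₀ x 0 = 0)
    (wτ : E → ℝ → ℝ)
    (hwτle : ∀ x : E, ∀ t : ℝ, t ≤ τ → wτ x t = 0)
    (hwτgt : ∀ x : E, ∀ t : ℝ, τ < t → wτ x t = w₀ x (t - τ))
    (η : E → ℝ → ℝ) (hη : ∀ x t, η x t = wτ x t - w₀ x t) :
    ∀ x x' : E, ∀ t ∈ Set.Icc (0 : ℝ) 1, ∀ t' ∈ Set.Icc (0 : ℝ) 1,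
      |η x t - η x' t'| ≤
        4 * A * τ ^ (α / 4) * (‖x - x'‖ ^ (α / 2) + |t - t'| ^ (α / 4)) := by
  intro x x' t ht t' ht'
  have hshift : ∀ y : E, ∀ r : ℝ, wτ y r = w₀ y (max (r - τ) 0) := by
    intro y r
    rcases le_or_gt r τ with h | h
    · rw [hwτle y r h, max_eq_right (by linarith), hzero]
    · rw [hwτgt y r h, max_eq_left (by linarith)]
  have hmem : ∀ r ∈ Set.Icc (0 : ℝ) 1, max (r - τ) 0 ∈ Set.Icc (0 : ℝ) 1 := fun r hr =>
    ⟨le_max_right _ _, max_le (by linarith [hr.2]) zero_le_one⟩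
  have hsq : ∀ a : ℝ, 0 ≤ a → ∀ b : ℝ, a ^ (2 * b) = (a ^ b) ^ 2 := by
    intro a ha b
    rw [mul_comm, Real.rpow_mul ha, Real.rpow_two]
  have hη_small : ∀ y : E, ∀ r ∈ Set.Icc (0 : ℝ) 1, |η y r| ≤ A * (τ ^ (α / 4)) ^ 2 := by
    intro y r hr
    rw [hη, hshift]
    refine (hHolder y y _ (hmem r hr) r hr).trans ?_
    rw [sub_self, norm_zero, Real.zero_rpow hα0.ne', zero_add, ← hsq τ hτ0.le,
      show 2 * (α / 4) = α / 2 by ring]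
    have hdist : |max (r - τ) 0 - r| ≤ τ := by
      rw [abs_le]
      exact ⟨by linarith [le_max_left (r - τ) 0],
        by linarith [max_le (show r - τ ≤ r + τ by linarith) (show 0 ≤ r + τ by linarith [hr.1])]⟩
    gcongr
  have hspace : ‖x - x'‖ ^ α = (‖x - x'‖ ^ (α / 2)) ^ 2 := by
    rw [← hsq _ (norm_nonneg _), show 2 * (α / 2) = α by ring]
  have htime : |t - t'| ^ (α / 2) = (|t - t'| ^ (α / 4)) ^ 2 := by
    rw [← hsq _ (abs_nonneg _), show 2 * (α / 4) = α / 2 by ring]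
  have hw := hHolder x x' t ht t' ht'
  have hw_shift : |w₀ x (max (t - τ) 0) - w₀ x' (max (t' - τ) 0)| ≤
      A * (‖x - x'‖ ^ α + |t - t'| ^ (α / 2)) := by
    refine (hHolder x x' _ (hmem t ht) _ (hmem t' ht')).trans ?_
    have hdist : |max (t - τ) 0 - max (t' - τ) 0| ≤ |t - t'| := by
      simpa using abs_max_sub_max_le_abs (t - τ) (t' - τ) 0
    gcongr
  rw [hspace, htime] at hw hw_shift
  have hη_holder : |η x t - η x' t'| ≤
      2 * A * ((‖x - x'‖ ^ (α / 2)) ^ 2 + (|t - t'| ^ (α / 4)) ^ 2) := by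
    rw [hη, hη, hshift, hshift, sub_sub_sub_comm]
    linarith [abs_sub (w₀ x (max (t - τ) 0) - w₀ x' (max (t' - τ) 0)) (w₀ x t - w₀ x' t')]
  have hη_tau : |η x t - η x' t'| ≤ 2 * A * (τ ^ (α / 4)) ^ 2 := by
    linarith [abs_sub (η x t) (η x' t'), hη_small x t ht, hη_small x' t' ht']
  have hP : 0 ≤ ‖x - x'‖ ^ (α / 2) := by positivity
  have hQ : 0 ≤ |t - t'| ^ (α / 4) := by positivity
  have hT : 0 ≤ τ ^ (α / 4) := by positivity
  generalize ‖x - x'‖ ^ (α / 2) = P at *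
  generalize |t - t'| ^ (α / 4) = Q at *
  generalize τ ^ (α / 4) = T at *
  have hTPQ : 0 ≤ A * (T * (P + Q)) := by positivity
  rcases le_total T (P + Q) with h | h
  · have : A * T ^ 2 ≤ A * (T * (P + Q)) := by
      rw [sq]
      gcongr
    linarith
  · have : A * (P ^ 2 + Q ^ 2) ≤ A * (T * (P + Q)) := by
      refine mul_le_mul_of_nonneg_left ?_ hA
      nlinarith [mul_nonneg hP hQ, mul_le_mul_of_nonneg_right h (add_nonneg hP hQ)]
    linarith
end
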